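/- Let d ≥ 2 be an even integer and let a, e be indeterminates. Let n be a positive integer with n ≡ d+1 (mod 2d). Set M = (n−1)/2 if d = 2, and M = (dn−n+1)/(2d) if d ≥ 4. Then Σ_{k=0}^{M} [3dk−1]_q · (q^{−1},e,q^{d−1}/e; q^{2d})_k (aq,q/a,q^{d−3}; q^d)_k / ((q^d,e,q^{d−1}/e; q^d)_k (aq^{2d−2},q^{2d−2}/a,q^{d+2}; q^{2d})_k) · q^{dk} ≡ 0 modulo Φ_n(q)(1−aq^n)(a−q^n), as a congruence of rational functions in q, a and e. -/

import Mathlib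

open Finset

noncomputable section

abbrev R3 : Type := MvPolynomial (Fin 3) ℚ
abbrev K3 : Type := FractionRing R3

/-- The variable `q` as a rational function in `ℚ(q,a,e)`. -/
def qv : K3 := algebraMap R3 K3 (MvPolynomial.X 0)

/-- The indeterminate `a` as a rational function in `ℚ(q,a,e)`. -/
def av : K3 := algebraMap R3 K3 (MvPolynomial.X 1)

/-- The indeterminate `e` as a rational function in `ℚ(q,a,e)`. -/
def ev : K3 := algebraMap R3 K3 (MvPolynomial.X 2)

/-- The q-shifted factorial `(a; q)_k = (1-a)(1-aq)⋯(1-aq^{k-1})`. -/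
def qPoch {R : Type*} [CommRing R] (a q : R) (k : ℕ) : R :=
  ∏ j ∈ Finset.range k, (1 - a * q ^ j)

/-- The q-integer `[m]_q = (1 - q^m)/(1 - q)`. -/
def qInt {K : Type*} [Field K] (q : K) (m : ℤ) : K := (1 - q ^ m) / (1 - q)

/-- The n-th cyclotomic polynomial `Φ_n(q)` viewed inside `ℚ[q,a,e]`. -/
def Phi3 (n : ℕ) : R3 := Polynomial.aeval (MvPolynomial.X 0) (Polynomial.cyclotomic n ℚ)

/-- `A ≡ B (mod M)`: the polynomial `M` divides the numerator of the reduced form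
of the rational function `A - B`. -/
def CongrMod3 (A B : K3) (M : R3) : Prop :=
  ∃ f g : R3, g ≠ 0 ∧ (∀ p : R3, Prime p → p ∣ g → ¬ p ∣ M) ∧
    (A - B) * algebraMap R3 K3 g = algebraMap R3 K3 M * algebraMap R3 K3 f

theorem qPoch_zero {R : Type*} [CommRing R] (a q : R) : qPoch a q 0 = 1 := by
  simp [qPoch]

theorem qPoch_succ {R : Type*} [CommRing R] (a q : R) (k : ℕ) :
    qPoch a q (k + 1) = qPoch a q k * (1 - a * q ^ k) := by
  simp [qPoch, prod_range_succ]

theorem one_sub_mul_qPoch {R : Type*} [CommRing R] (a q : R) (k : ℕ) :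
    (1 - a) * qPoch (a * q) q k = qPoch a q k * (1 - a * q ^ k) := by
  induction k with
  | zero => simp [qPoch]
  | succ k ih =>
    rw [qPoch_succ, qPoch_succ, ← mul_assoc, ih]
    ring

theorem one_sub_mul_one_sub_mul_qPoch {R : Type*} [CommRing R] (a q : R) (k : ℕ) :
    (1 - a) * (1 - a * q) * qPoch (a * q ^ 2) q k
      = qPoch a q k * ((1 - a * q ^ k) * (1 - a * q * q ^ k)) := by
  have h := one_sub_mul_qPoch (a * q) q k
  rw [show a * q ^ 2 = a * q * q by ring, mul_assoc, h, ← mul_assoc, one_sub_mul_qPoch]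
  ring

theorem qPoch_eq_zero {R : Type*} [CommRing R] {a q : R} {N k : ℕ} (h : a * q ^ N = 1)
    (hk : N < k) : qPoch a q k = 0 :=
  prod_eq_zero (mem_range.2 hk) (by rw [h, sub_self])

theorem qPoch_ne_zero {R : Type*} [CommRing R] [IsDomain R] {a q : R} {k : ℕ}
    (h : ∀ j < k, a * q ^ j ≠ 1) : qPoch a q k ≠ 0 :=
  prod_ne_zero_iff.2 fun j hj => sub_ne_zero.2 (h j (mem_range.1 hj)).symm

/-- The summand of Rahman's quadratic summation without its very-well-poised factor
`1 - A p ^ (3k)`; the parameters are meant to satisfy `A p = B C F = E H`. -/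
def quadWeight {L : Type*} [Field L] (p A B C F E H : L) (k : ℕ) : L :=
  (qPoch A (p ^ 2) k * qPoch E (p ^ 2) k * qPoch H (p ^ 2) k) *
    (qPoch B p k * qPoch C p k * qPoch F p k) * p ^ k /
    (qPoch p p k * qPoch E p k * qPoch H p k *
      (qPoch (B * F * p) (p ^ 2) k * qPoch (C * F * p) (p ^ 2) k * qPoch (B * C * p) (p ^ 2) k))

/-- The summand of Rahman's quadratic summation. -/
def quadTerm {L : Type*} [Field L] (p A B C F E H : L) (k : ℕ) : L :=
  (1 - A * p ^ (3 * k)) * quadWeight p A B C F E H k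

theorem quadWeight_succ {L : Type*} [Field L] (p A B C F E H : L) (k : ℕ) :
    quadWeight p A B C F E H (k + 1) = quadWeight p A B C F E H k *
      (((1 - A * (p ^ k) ^ 2) * (1 - E * (p ^ k) ^ 2) * (1 - H * (p ^ k) ^ 2) *
        ((1 - B * p ^ k) * (1 - C * p ^ k) * (1 - F * p ^ k)) * p) /
      ((1 - p * p ^ k) * (1 - E * p ^ k) * (1 - H * p ^ k) *
        ((1 - B * F * p * (p ^ k) ^ 2) * (1 - C * F * p * (p ^ k) ^ 2) *
          (1 - B * C * p * (p ^ k) ^ 2)))) := by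
  have h2 : (p ^ 2) ^ k = (p ^ k) ^ 2 := by rw [← pow_mul, ← pow_mul, mul_comm]
  simp only [quadWeight, qPoch_succ, h2, pow_succ p k]
  rw [div_mul_div_comm]
  congr 1 <;> ac_rfl

theorem quadWeight_swap {L : Type*} [Field L] (p A B C F E H : L) (k : ℕ) :
    quadWeight p A B C F E H k = quadWeight p A C B F E H k := by
  unfold quadWeight
  rw [mul_comm B C]
  congr 1 <;> ac_rfl

theorem quadWeight_shift_BC {L : Type*} [Field L] {p A B c F E H : L} {k : ℕ}
    (hB : 1 - B ≠ 0) (hBp : 1 - B * p ≠ 0) (hcx : 1 - c * p ^ k ≠ 0)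
    (hcpx : 1 - c * p * p ^ k ≠ 0) (hBF : 1 - B * F * p ≠ 0)
    (hcFx : 1 - c * F * p * (p ^ k) ^ 2 ≠ 0) :
    quadWeight p A (B * p ^ 2) c F E H k = quadWeight p A B (c * p ^ 2) F E H k *
      (((1 - B * p ^ k) * (1 - B * p * p ^ k) * ((1 - c) * (1 - c * p)) *
        (1 - B * F * p) * (1 - c * F * p * (p ^ k) ^ 2)) /
      ((1 - B) * (1 - B * p) * ((1 - c * p ^ k) * (1 - c * p * p ^ k)) *
        (1 - B * F * p * (p ^ k) ^ 2) * (1 - c * F * p))) := by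
  have h2 : (p ^ 2) ^ k = (p ^ k) ^ 2 := by rw [← pow_mul, ← pow_mul, mul_comm]
  have e1 := one_sub_mul_one_sub_mul_qPoch B p k
  have e2 := one_sub_mul_one_sub_mul_qPoch c p k
  have e3 := one_sub_mul_qPoch (B * F * p) (p ^ 2) k
  have e4 := one_sub_mul_qPoch (c * F * p) (p ^ 2) k
  rw [h2] at e3 e4
  rw [mul_comm, ← eq_div_iff (mul_ne_zero hB hBp)] at e1
  rw [← div_eq_iff (mul_ne_zero hcx hcpx)] at e2
  rw [mul_comm, ← eq_div_iff hBF] at e3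
  rw [← div_eq_iff hcFx] at e4
  simp only [quadWeight]
  rw [show B * p ^ 2 * F * p = B * F * p * p ^ 2 by ring,
    show c * p ^ 2 * F * p = c * F * p * p ^ 2 by ring,
    show B * p ^ 2 * c * p = B * (c * p ^ 2) * p by ring, e1, ← e2, e3, ← e4]
  simp only [div_eq_mul_inv, mul_inv, inv_inv]
  ring

theorem telescoping_poly_BC {R : Type*} [CommRing R] {p x A B c F E H : R}
    (hA : A = B * c * F * p) (hE : A * p = E * H) :
    (1 - A * x ^ 3) * x * (c * ((p * B - E) * (p * B - H)) * (1 - B) *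
        ((1 - c * x) * (1 - c * p * x)) * (1 - B * F * p * x ^ 2) -
      B * ((p * c - E) * (p * c - H)) * (1 - c) *
        ((1 - B * x) * (1 - B * p * x)) * (1 - c * F * p * x ^ 2)) =
    B * c * (B - c) * (p ^ 2 * (1 - A * x ^ 2) * ((1 - E * x ^ 2) * (1 - H * x ^ 2)) *
        (1 - B * x) * (1 - F * x) * (1 - c * x) -
      (1 - x) * ((p - E * x) * (p - H * x)) * (1 - B * c * p * x ^ 2) *
        (1 - c * F * p * x ^ 2) * (1 - B * F * p * x ^ 2)) := by
  have h1 : (p * B - E) * (p * B - H) = p * (p * B ^ 2 - (E + H) * B + A) := by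
    linear_combination -hE
  have h2 : (p * c - E) * (p * c - H) = p * (p * c ^ 2 - (E + H) * c + A) := by
    linear_combination -hE
  have h3 : (1 - E * x ^ 2) * (1 - H * x ^ 2) = 1 - (E + H) * x ^ 2 + A * p * x ^ 4 := by
    linear_combination -x ^ 4 * hE
  have h4 : (p - E * x) * (p - H * x) = p * (p - (E + H) * x + A * x ^ 2) := by
    linear_combination -x ^ 2 * hE
  rw [h1, h2, h3, h4]
  subst hA
  ring

/-- The telescoping relation between the summands with parameters `(B, c p²)` and `(B p², c)`. -/
theorem quadTerm_telescope_BC {L : Type*} [Field L] {p A B c F E H : L} (k : ℕ)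
    (hp : p ≠ 0) (hA : A = B * c * F * p) (hE : A * p = E * H)
    (hB : 1 - B ≠ 0) (hBp : 1 - B * p ≠ 0) (hBF : 1 - B * F * p ≠ 0) (hcF : 1 - c * F * p ≠ 0)
    (hc : ∀ j : ℕ, 1 - c * p ^ j ≠ 0) (hpk : 1 - p * p ^ k ≠ 0)
    (hEk : 1 - E * p ^ k ≠ 0) (hHk : 1 - H * p ^ k ≠ 0)
    (hBFk : 1 - B * F * p * (p ^ k) ^ 2 ≠ 0) (hcFk : 1 - c * F * p * (p ^ k) ^ 2 ≠ 0)
    (hcFk' : 1 - c * p ^ 2 * F * p * (p ^ k) ^ 2 ≠ 0)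
    (hBck : 1 - B * (c * p ^ 2) * p * (p ^ k) ^ 2 ≠ 0)
    (G : ℕ → L)
    (hG : G = fun k => quadWeight p A B (c * p ^ 2) F E H k * (B * c * (B - c) * (1 - p ^ k) *
      ((p - E * p ^ k) * (p - H * p ^ k)) * (1 - B * c * p * (p ^ k) ^ 2) *
      (1 - c * F * p * (p ^ k) ^ 2)) / (p ^ k * ((1 - c * p ^ k) * (1 - c * p ^ (k + 1))))) :
    c * ((p * B - E) * (p * B - H)) * (1 - B) * quadTerm p A B (c * p ^ 2) F E H k -
      B * ((p * c - E) * (p * c - H)) * ((1 - B) * (1 - B * p) * (1 - c * F * p) /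
        ((1 - c * p) * (1 - B * F * p))) * quadTerm p A (B * p ^ 2) c F E H k =
      G (k + 1) - G k := by
  have hcx := hc k
  have hcpx : 1 - c * p * p ^ k ≠ 0 := by
    have := hc (k + 1)
    rwa [pow_succ', ← mul_assoc] at this
  have hcppx : 1 - c * p ^ 2 * p ^ k ≠ 0 := by
    have := hc (k + 2)
    rwa [pow_add, mul_comm (p ^ k), ← mul_assoc] at this
  have hcp : 1 - c * p ≠ 0 := by simpa using hc 1
  have hc1 : 1 - c ≠ 0 := by simpa using hc 0
  have hx : p ^ k ≠ 0 := pow_ne_zero _ hp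
  have key := telescoping_poly_BC (x := p ^ k) hA hE
  simp only [hG, quadTerm, quadWeight_succ]
  rw [quadWeight_shift_BC hB hBp hcx hcpx hBF hcFk, pow_mul' p 3 k, pow_succ' p (k + 1),
    pow_succ' p k]
  generalize quadWeight p A B (c * p ^ 2) F E H k = U at *
  generalize p ^ k = x at *
  have e1 : 1 - c * p ^ 2 * F * p * x ^ 2 = 1 - c * F * p * (p * x) ^ 2 := by ring
  have e2 : 1 - B * (c * p ^ 2) * p * x ^ 2 = 1 - B * c * p * (p * x) ^ 2 := by ring
  have e3 : p - E * (p * x) = p * (1 - E * x) := by ring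
  have e4 : p - H * (p * x) = p * (1 - H * x) := by ring
  have e5 : 1 - c * (p * (p * x)) = 1 - c * p ^ 2 * x := by ring
  have e6 : 1 - c * (p * x) = 1 - c * p * x := by ring
  rw [e1] at hcFk'
  rw [e2] at hBck
  rw [e1, e2, e3, e4, e5, e6]
  clear hG hA hE e1 e2 e3 e4 e5 e6
  generalize 1 - c * F * p * (p * x) ^ 2 = y1 at *
  generalize 1 - B * c * p * (p * x) ^ 2 = y2 at *
  generalize 1 - c * p ^ 2 * x = y3 at *
  generalize 1 - c * p * x = y4 at *
  generalize 1 - c * x = y5 at *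
  generalize 1 - E * x = y6 at *
  generalize 1 - H * x = y7 at *
  generalize 1 - p * x = y8 at *
  generalize 1 - B * F * p * x ^ 2 = y9 at *
  generalize 1 - c * F * p * x ^ 2 = z1 at *
  generalize 1 - B * F * p = z2 at *
  generalize 1 - c * F * p = z3 at *
  generalize 1 - c * p = z4 at *
  generalize 1 - B * p = z5 at *
  generalize 1 - B = z6 at *
  generalize 1 - c = z7 at *
  generalize (p * B - E) * (p * B - H) = u at *
  generalize (p * c - E) * (p * c - H) = v at *
  generalize 1 - A * x ^ 3 = w at *
  have l1 : ∀ b1 b2 : L, c * u * z6 * (w * U) - B * v * (z6 * z5 * z3 / (z4 * z2)) *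
        (w * (U * (b1 * b2 * (z7 * z4) * z2 * z1 / (z6 * z5 * (y5 * y4) * y9 * z3)))) =
      U * (w * x * (c * u * z6 * (y5 * y4) * y9 - B * v * z7 * (b1 * b2) * z1)) /
        (x * (y5 * y4) * y9) := by
    intro b1 b2
    field_simp
  rw [l1, key]
  field_simp

theorem quadTerm_sum_eq_zero_of_B {L : Type*} [Field L] {p A F E H : L} (m : ℕ)
    (hp : p ≠ 0) (hA0 : A ≠ 0) (hE : A * p = E * H)
    (hp1 : ∀ i : ℕ, p * p ^ i ≠ 1) (hE1 : ∀ i : ℕ, E * p ^ i ≠ 1) (hH1 : ∀ i : ℕ, H * p ^ i ≠ 1)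
    (hF1 : ∀ i : ℤ, F * p ^ i ≠ 1) (hA1 : ∀ i : ℕ, A * p ^ i ≠ 1) :
    ∀ {B C : L}, A * p = B * C * F → B * p ^ (2 * m + 1) = 1 →
      (∀ i : ℕ, B * C * p * p ^ i ≠ 1) → ∀ K > 2 * m + 1,
      ∑ k ∈ range K, quadTerm p A B C F E H k = 0 := by
  induction m with
  | zero =>
    intro B C hA hB hBC K hK
    have hBp : B * p = 1 := by simpa using hB
    have hzero : ∀ k ≥ 2, quadTerm p A B C F E H k = 0 := fun k hk => by
      simp [quadTerm, quadWeight, qPoch_eq_zero hB (show 2 * 0 + 1 < k by omega)]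
    rw [← sum_subset (range_subset_range.2 (show 2 ≤ K by omega))
      (fun k _ hk => hzero k (by simp at hk; omega)), sum_range_succ, sum_range_succ, sum_range_zero]
    have hC : 1 - C ≠ 0 := sub_ne_zero.2 fun h => hBC 0 (by
      rw [← h]; simpa using hBp)
    have hF : 1 - F ≠ 0 := sub_ne_zero.2 fun h => hF1 0 (by simp [← h])
    have hA3 : 1 - A * p ^ 3 ≠ 0 := sub_ne_zero.2 (hA1 3).symm
    have hE0 : 1 - E ≠ 0 := sub_ne_zero.2 fun h => hE1 0 (by simp [← h])
    have hH0 : 1 - H ≠ 0 := sub_ne_zero.2 fun h => hH1 0 (by simp [← h])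
    have hp0 : 1 - p ≠ 0 := sub_ne_zero.2 fun h => hp1 0 (by simp [← h])
    have e1 : B * F * p = F := by linear_combination F * hBp
    have e2 : C * F * p = A * p ^ 3 := by linear_combination -p ^ 2 * hA - C * F * p * hBp
    have e3 : B * C * p = C := by linear_combination C * hBp
    simp only [quadTerm, quadWeight, qPoch, prod_range_zero, prod_range_one, e1, e2, e3]
    simp only [pow_zero, mul_one, mul_zero, pow_one, div_one, zero_add]
    field_simp
    linear_combination (-(1 - A)) * hBp
  | succ m ih =>
    intro B C hA hB hBC K hK
    obtain ⟨c, rfl⟩ : ∃ c, C = c * p ^ 2 := ⟨C / p ^ 2, by field_simp⟩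
    have hA' : A = B * c * F * p := mul_right_cancel₀ hp (by rw [hA]; ring)
    have hB0 : B ≠ 0 := left_ne_zero_of_mul_eq_one hB
    have hBzpow : B = p ^ (-((2 * (m + 1) + 1 : ℕ) : ℤ)) := by
      rw [zpow_neg, zpow_natCast]; exact eq_inv_of_mul_eq_one_left hB
    have hc : ∀ j : ℕ, 1 - c * p ^ j ≠ 0 := fun j => sub_ne_zero.2 fun h =>
      hBC (2 * m + j) (by linear_combination (c * p ^ j) * hB - h)
    have hBpow : ∀ j : ℕ, 0 < j → j < 2 * m + 3 → 1 - B * p ^ j ≠ 0 := fun j hj hj' =>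
      sub_ne_zero.2 fun h => hp1 (2 * m + 3 - j - 1) (by
        have : p ^ j * (p * p ^ (2 * m + 3 - j - 1)) = p ^ (2 * (m + 1) + 1) := by
          rw [← pow_succ', ← pow_add]; congr 1; omega
        rw [← hB, ← this, ← mul_assoc, ← h, one_mul])
    have hBF : ∀ j : ℕ, 1 - B * F * p * p ^ j ≠ 0 := fun j => sub_ne_zero.2 fun h =>
      hF1 (-((2 * (m + 1) + 1 : ℕ) : ℤ) + 1 + j) (by
        rw [zpow_add₀ hp, zpow_add₀ hp, ← hBzpow, zpow_one, zpow_natCast, h]; ring)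
    have hcF : ∀ j : ℕ, 1 - c * F * p * p ^ j ≠ 0 := fun j => sub_ne_zero.2 fun h =>
      hA1 (2 * m + 3 + j) (by
        rw [hA', h]; linear_combination (c * F * p * p ^ j) * hB)
    have hB1 : 1 - B ≠ 0 := sub_ne_zero.2 fun h => hp1 (2 * m + 2) (by
      rw [← hB, ← h]; ring)
    set G : ℕ → L := fun k => quadWeight p A B (c * p ^ 2) F E H k *
      (B * c * (B - c) * (1 - p ^ k) *
      ((p - E * p ^ k) * (p - H * p ^ k)) * (1 - B * c * p * (p ^ k) ^ 2) *
      (1 - c * F * p * (p ^ k) ^ 2)) / (p ^ k * ((1 - c * p ^ k) * (1 - c * p ^ (k + 1)))) with hG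
    have tel := sum_congr (rfl : range K = range K) fun k _ =>
      quadTerm_telescope_BC k hp hA' hE hB1 (by simpa using hBpow 1 (by omega) (by omega))
        (by simpa using hBF 0) (by simpa using hcF 0) hc (sub_ne_zero.2 (hp1 k).symm)
        (sub_ne_zero.2 (hE1 k).symm) (sub_ne_zero.2 (hH1 k).symm)
        (by rw [← pow_mul]; exact hBF _) (by rw [← pow_mul]; exact hcF _)
        (by rw [show c * p ^ 2 * F * p * (p ^ k) ^ 2 = c * F * p * p ^ (2 + k * 2) by ring]
            exact hcF _)
        (by rw [← pow_mul]; exact sub_ne_zero.2 (hBC _).symm) G hG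
    have hG0 : G 0 = 0 := by simp [hG]
    have hGK : G K = 0 := by
      simp [hG, quadWeight, qPoch_eq_zero hB (show 2 * (m + 1) + 1 < K by omega)]
    rw [sum_range_sub, hG0, hGK, sub_zero, sum_sub_distrib, ← mul_sum, ← mul_sum,
      ih (B := B * p ^ 2) (C := c) (by rw [hA]; ring) (by rw [← hB]; ring)
        (fun i => by rw [show B * p ^ 2 * c * p = B * (c * p ^ 2) * p by ring]; exact hBC i)
        K (by omega), mul_zero, sub_zero] at tel
    have hc0 : c ≠ 0 := by
      rintro rfl
      exact hA0 (by rw [hA']; ring)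
    have hu : ∀ Z : L, (∀ i : ℕ, Z * p ^ i ≠ 1) → p * B - Z ≠ 0 := fun Z hZ h =>
      hZ (2 * m + 2) (by rw [← sub_eq_zero.1 h, ← hB]; ring)
    exact (mul_eq_zero.1 tel).resolve_left
      (mul_ne_zero (mul_ne_zero hc0 (mul_ne_zero (hu E hE1) (hu H hH1))) hB1)

theorem quadWeight_shift_AFH {L : Type*} [Field L] {p A B C F E H : L} {k : ℕ}
    (hH : 1 - H ≠ 0) (hHp : 1 - H * p ≠ 0) (hHx : 1 - H * p ^ k ≠ 0)
    (hHpx : 1 - H * p * p ^ k ≠ 0)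
    (hBF : 1 - B * F * p ≠ 0) (hCF : 1 - C * F * p ≠ 0)
    (hBFx : 1 - B * F * p * (p ^ k) ^ 2 ≠ 0) (hCFx : 1 - C * F * p * (p ^ k) ^ 2 ≠ 0) :
    (1 - A) * (1 - F) * (1 - F * p) * quadWeight p (A * p ^ 2) B C (F * p ^ 2) E (H * p ^ 2) k =
      quadWeight p A B C F E H k *
      (((1 - A * (p ^ k) ^ 2) * (1 - H * (p ^ k) ^ 2) * ((1 - F * p ^ k) * (1 - F * p * p ^ k)) *
        (1 - H * p) * (1 - B * F * p) * (1 - C * F * p)) /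
      ((1 - H * p ^ k) * (1 - H * p * p ^ k) *
        (1 - B * F * p * (p ^ k) ^ 2) * (1 - C * F * p * (p ^ k) ^ 2))) := by
  have h2 : (p ^ 2) ^ k = (p ^ k) ^ 2 := by rw [← pow_mul, ← pow_mul, mul_comm]
  have e1 := one_sub_mul_qPoch A (p ^ 2) k
  have e2 := one_sub_mul_one_sub_mul_qPoch F p k
  have e3 := one_sub_mul_qPoch (B * F * p) (p ^ 2) k
  have e4 := one_sub_mul_qPoch (C * F * p) (p ^ 2) k
  have e5 := one_sub_mul_qPoch H (p ^ 2) k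
  have e6 := one_sub_mul_one_sub_mul_qPoch H p k
  rw [h2] at e1 e3 e4 e5
  rw [mul_comm, ← eq_div_iff hH] at e5
  rw [← div_eq_iff hBFx] at e3
  rw [← div_eq_iff hCFx] at e4
  rw [← div_eq_iff (mul_ne_zero hHx hHpx)] at e6
  simp only [quadWeight]
  rw [show B * (F * p ^ 2) * p = B * F * p * p ^ 2 by ring,
    show C * (F * p ^ 2) * p = C * F * p * p ^ 2 by ring, ← e3, ← e4, e5, ← e6]
  have e : ∀ T r s : L, (1 - A) * (1 - F) * (1 - F * p) *
      (qPoch (A * p ^ 2) (p ^ 2) k * r * (T / (1 - H)) * (s * qPoch (F * p ^ 2) p k)) =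
      qPoch A (p ^ 2) k * (1 - A * (p ^ k) ^ 2) * r * (T / (1 - H)) *
      (s * (qPoch F p k * ((1 - F * p ^ k) * (1 - F * p * p ^ k)))) := by
    intro T r s
    rw [← e1, ← e2]; ring
  rw [← mul_div_assoc, ← mul_assoc ((1 - A) * (1 - F) * (1 - F * p)), e]
  generalize qPoch (H * p ^ 2) p k = w0
  generalize qPoch (B * F * p * p ^ 2) (p ^ 2) k = w1
  generalize qPoch (C * F * p * p ^ 2) (p ^ 2) k = w2
  generalize qPoch (B * C * p) (p ^ 2) k = w3
  clear e e1 e2 e3 e4 e5 e6 h2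
  generalize qPoch A (p ^ 2) k = w4
  generalize qPoch E (p ^ 2) k = w5
  generalize qPoch H (p ^ 2) k = w6
  generalize qPoch p p k * qPoch E p k = w7
  generalize qPoch B p k * qPoch C p k = w8
  generalize qPoch F p k = w9
  generalize p ^ k = x at *
  generalize 1 - H * p * x = y1 at *
  generalize 1 - H * x = y2 at *
  generalize 1 - H * p = y3 at *
  generalize 1 - H = y4 at *
  generalize 1 - B * F * p * x ^ 2 = y5 at *
  generalize 1 - C * F * p * x ^ 2 = y6 at *
  generalize 1 - B * F * p = y7 at *
  generalize 1 - C * F * p = y8 at *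
  have hden : w7 * (y4 * y3 * w0 / (y2 * y1)) * (y7 * w1 / y5 * (y8 * w2 / y6) * w3) =
      (w7 * w0 * (w1 * w2 * w3)) * ((y4 * y3 * y7 * y8) / (y2 * y1 * y5 * y6)) := by ring
  rw [hden]
  generalize w7 * w0 * (w1 * w2 * w3) = D
  rw [div_mul_eq_div_div, div_eq_mul_inv _ D, div_eq_mul_inv _ D]
  generalize D⁻¹ = D'
  generalize 1 - A * x ^ 2 = z1
  generalize 1 - H * x ^ 2 = z2
  generalize 1 - F * x = z3
  generalize 1 - F * p * x = z4
  have hq : y3 * y7 * y8 / (y2 * y1 * y5 * y6) / (y4 * y3 * y7 * y8 / (y2 * y1 * y5 * y6)) =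
      y4⁻¹ := by field_simp
  linear_combination (-(w4 * w5 * w6 * w8 * w9 * x * D' * z1 * z2 * z3 * z4)) * hq

theorem telescoping_poly_AFH {L : Type*} [Field L] {p x A B C F E H : L}
    (hp : p ≠ 0) (hF : F ≠ 0) (hA : A * p = B * C * F) (hE : A * p = E * H) :
    p * (1 - F) * (F * p - E) * (1 - A * x ^ 3) * (x * (1 - H * x) * (1 - H * p * x) *
        ((1 - B * F * p * x ^ 2) * (1 - C * F * p * x ^ 2))) +
      p * (E - F * p * (B + C) + F * p ^ 2 * H) * (1 - A * p ^ 2 * x ^ 3) *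
        (x * (1 - A * x ^ 2) * (1 - H * x ^ 2) * ((1 - F * x) * (1 - F * p * x))) =
    F * (p ^ 2 * ((1 - A * x ^ 2) * (1 - E * x ^ 2) * (1 - H * x ^ 2) * ((1 - B * x) * (1 - C * x))
        * (1 - F * x) * (1 - H * F * (p * x) ^ 2)) -
      (1 - x) * (p - E * x) * (p - B * C * x ^ 2) * (1 - H * F * x ^ 2) * (1 - H * p * x) *
        ((1 - B * F * p * x ^ 2) * (1 - C * F * p * x ^ 2))) := by
  obtain ⟨g, rfl⟩ : ∃ g, F = p * g := ⟨F / p, by field_simp⟩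
  have hg : g ≠ 0 := right_ne_zero_of_mul hF
  obtain ⟨h, rfl⟩ : ∃ h, H = p * g * h := ⟨H / (p * g), by field_simp⟩
  obtain rfl : A = E * h * g := mul_right_cancel₀ hp (by rw [hE]; ring)
  have hBC : B * C = E * h := mul_right_cancel₀ hF (by rw [← hA]; ring)
  have h1 : (1 - B * (p * g) * p * x ^ 2) * (1 - C * (p * g) * p * x ^ 2) =
      1 - (B + C) * (p * g) * p * x ^ 2 + E * h * (p * g) ^ 2 * p ^ 2 * x ^ 4 := by
    rw [← hBC]; ring
  have h2 : (1 - B * x) * (1 - C * x) = 1 - (B + C) * x + E * h * x ^ 2 := by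
    rw [← hBC]; ring
  rw [h1, h2, hBC]
  ring

/-- The telescoping relation between the summands with parameters `(A, F, H)` and
`(A p², F p², H p²)`. -/
theorem quadTerm_telescope_AFH {L : Type*} [Field L] {p A B C F E H : L} (k : ℕ)
    (hp : p ≠ 0) (hF : F ≠ 0) (hA : A * p = B * C * F) (hE : A * p = E * H)
    (hH : ∀ j : ℕ, 1 - H * p ^ j ≠ 0)
    (hBF : 1 - B * F * p ≠ 0) (hCF : 1 - C * F * p ≠ 0)
    (hpk : 1 - p * p ^ k ≠ 0) (hEk : 1 - E * p ^ k ≠ 0)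
    (hBFk : 1 - B * F * p * (p ^ k) ^ 2 ≠ 0) (hCFk : 1 - C * F * p * (p ^ k) ^ 2 ≠ 0)
    (hBCk : 1 - B * C * p * (p ^ k) ^ 2 ≠ 0)
    (G : ℕ → L)
    (hG : G = fun k => quadWeight p A B C F E H k * (F * (1 - p ^ k) * (p - E * p ^ k) *
      (p - B * C * (p ^ k) ^ 2) * (1 - H * F * (p ^ k) ^ 2)) / (p ^ k * (1 - H * p ^ k))) :
    p * (1 - F) * (F * p - E) * quadTerm p A B C F E H k +
      p * (E - F * p * (B + C) + F * p ^ 2 * H) * ((1 - A) * (1 - F) * (1 - F * p) /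
        ((1 - H * p) * (1 - B * F * p) * (1 - C * F * p))) *
        quadTerm p (A * p ^ 2) B C (F * p ^ 2) E (H * p ^ 2) k =
      G (k + 1) - G k := by
  have hHx := hH k
  have hHpx : 1 - H * p * p ^ k ≠ 0 := by
    have := hH (k + 1)
    rwa [pow_succ', ← mul_assoc] at this
  have hHp : 1 - H * p ≠ 0 := by simpa using hH 1
  have hH1 : 1 - H ≠ 0 := by simpa using hH 0
  have hx : p ^ k ≠ 0 := pow_ne_zero _ hp
  have key := telescoping_poly_AFH (x := p ^ k) hp hF hA hE
  have shift := quadWeight_shift_AFH (A := A) (E := E) hH1 hHp hHx hHpx hBF hCF hBFk hCFk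
  simp only [hG, quadTerm, quadWeight_succ]
  rw [pow_mul' p 3 k, pow_succ' p k]
  generalize quadWeight p A B C F E H k = U at *
  generalize quadWeight p (A * p ^ 2) B C (F * p ^ 2) E (H * p ^ 2) k = V at *
  generalize p ^ k = x at *
  have e1 : p - E * (p * x) = p * (1 - E * x) := by ring
  have e2 : p - B * C * (p * x) ^ 2 = p * (1 - B * C * p * x ^ 2) := by ring
  have e3 : 1 - H * (p * x) = 1 - H * p * x := by ring
  rw [e1, e2, e3]
  clear hG hA hE e1 e2 e3 hH
  generalize 1 - H * F * (p * x) ^ 2 = y1 at *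
  generalize 1 - H * F * x ^ 2 = y2 at *
  generalize 1 - B * F * p * x ^ 2 = y3 at *
  generalize 1 - C * F * p * x ^ 2 = y4 at *
  generalize 1 - B * F * p = y5 at *
  generalize 1 - C * F * p = y6 at *
  generalize 1 - B * C * p * x ^ 2 = y7 at *
  generalize 1 - H * p * x = y8 at *
  generalize 1 - H * x = y9 at *
  generalize 1 - H * p = z1 at *
  generalize 1 - E * x = z2 at *
  generalize 1 - p * x = z3 at *
  generalize E - F * p * (B + C) + F * p ^ 2 * H = v at *
  generalize F * p - E = u at *
  generalize 1 - A * x ^ 3 = w at *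
  generalize 1 - A * p ^ 2 * x ^ 3 = w' at *
  generalize 1 - A * x ^ 2 = z4 at *
  generalize 1 - H * x ^ 2 = z5 at *
  generalize 1 - F * p * x = z6 at *
  generalize 1 - F * x = z7 at *
  generalize 1 - E * x ^ 2 = z8 at *
  generalize 1 - F * p = r1 at *
  generalize 1 - F = r2 at *
  generalize 1 - A = r3 at *
  have l1 : p * r2 * u * (w * U) + p * v * (r3 * r2 * r1 / (z1 * y5 * y6)) * (w' * V) =
      U * (p * r2 * u * w * (x * y9 * y8 * (y3 * y4)) +
        p * v * w' * (x * z4 * z5 * (z7 * z6))) / (x * y9 * y8 * (y3 * y4)) := by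
    rw [show p * v * (r3 * r2 * r1 / (z1 * y5 * y6)) * (w' * V) =
      p * v * w' * (r3 * r2 * r1 * V) / (z1 * y5 * y6) by ring, shift]
    field_simp
  rw [l1, key]
  field_simp

theorem quadTerm_sum_eq_zero_of_A {L : Type*} [Field L] {p B C E : L} (N : ℕ) (hp : p ≠ 0)
    (hE1 : ∀ i : ℕ, E * p ^ i ≠ 1) :
    ∀ {A F H : L}, A * p = B * C * F → A * p = E * H → A * p ^ (2 * N) = 1 →
      (∀ i ≤ N, p * p ^ i ≠ 1) → (∀ i ≤ N, B * C * p * p ^ (2 * i) ≠ 1) →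
      (∀ i : ℕ, H * p ^ i ≠ 1) → (∀ i : ℕ, F * p ^ i ≠ E) →
      (∀ i : ℕ, B * F * p ^ i ≠ 1) → (∀ i : ℕ, C * F * p ^ i ≠ 1) →
      ∑ k ∈ range (N + 1), quadTerm p A B C F E H k = 0 := by
  induction N with
  | zero =>
    intro A F H _ _ hA _ _ _ _ _ _
    have : A = 1 := by simpa using hA
    simp [quadTerm, this]
  | succ N ih =>
    intro A F H hA hE hAN hp1 hBC hH hF hBF hCF
    have hA0 : A ≠ 0 := left_ne_zero_of_mul_eq_one hAN
    have hF0 : F ≠ 0 := right_ne_zero_of_mul (hA ▸ mul_ne_zero hA0 hp)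
    have hF1 : 1 - F ≠ 0 := sub_ne_zero.2 fun h => hBC N (by omega) (by
      linear_combination hAN - p ^ (2 * N + 1) * hA + p ^ (2 * N + 1) * B * C * h)
    have hFE : F * p - E ≠ 0 := sub_ne_zero.2 (by simpa using hF 1)
    have hH' : ∀ j : ℕ, 1 - H * p ^ j ≠ 0 := fun j => sub_ne_zero.2 (hH j).symm
    set G : ℕ → L := fun k => quadWeight p A B C F E H k * (F * (1 - p ^ k) * (p - E * p ^ k) *
      (p - B * C * (p ^ k) ^ 2) * (1 - H * F * (p ^ k) ^ 2)) / (p ^ k * (1 - H * p ^ k)) with hG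
    have tel := sum_congr (rfl : range (N + 1 + 1) = range (N + 1 + 1)) fun k hk =>
      quadTerm_telescope_AFH k hp hF0 hA hE hH'
        (sub_ne_zero.2 (by simpa using (hBF 1).symm)) (sub_ne_zero.2 (by simpa using (hCF 1).symm))
        (sub_ne_zero.2 (hp1 k (by have := mem_range.1 hk; omega)).symm)
        (sub_ne_zero.2 (hE1 k).symm)
        (by rw [show B * F * p * (p ^ k) ^ 2 = B * F * p ^ (1 + k * 2) by ring]
            exact sub_ne_zero.2 (hBF _).symm)
        (by rw [show C * F * p * (p ^ k) ^ 2 = C * F * p ^ (1 + k * 2) by ring]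
            exact sub_ne_zero.2 (hCF _).symm)
        (by rw [← pow_mul, mul_comm k]
            exact sub_ne_zero.2 (hBC k (by have := mem_range.1 hk; omega)).symm) G hG
    have hG0 : G 0 = 0 := by simp [hG]
    have hGN : G (N + 1 + 1) = 0 := by
      simp [hG, quadWeight, qPoch_eq_zero (a := A) (q := p ^ 2) (N := N + 1)
        (by rw [← pow_mul]; exact hAN) (Nat.lt_succ_self _)]
    have hsum : ∑ k ∈ range (N + 1 + 1),
        quadTerm p (A * p ^ 2) B C (F * p ^ 2) E (H * p ^ 2) k = 0 := by
      have hA' : A * p ^ 2 * p ^ (2 * N) = 1 := by rw [← hAN]; ring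
      rw [sum_range_succ, ih (by linear_combination p ^ 2 * hA) (by linear_combination p ^ 2 * hE)
        hA' (fun i hi => hp1 i (by omega)) (fun i hi => hBC i (by omega))
        (fun i => by rw [mul_assoc, ← pow_add]; exact hH _)
        (fun i => by rw [mul_assoc, ← pow_add]; exact hF _)
        (fun i => by rw [← mul_assoc, mul_assoc, ← pow_add]; exact hBF _)
        (fun i => by rw [← mul_assoc, mul_assoc, ← pow_add]; exact hCF _)]
      simp [quadTerm, quadWeight, qPoch_eq_zero (a := A * p ^ 2) (q := p ^ 2) (N := N)
        (by rw [← pow_mul]; exact hA') (Nat.lt_succ_self _)]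
    rw [sum_range_sub, hG0, hGN, sub_zero, sum_add_distrib, ← mul_sum, ← mul_sum, hsum, mul_zero,
      add_zero] at tel
    exact (mul_eq_zero.1 tel).resolve_left (mul_ne_zero (mul_ne_zero hp hF1) hFE)

/-- `x : K3` takes the value `y` under the specialization `φ`: it is a fraction whose denominator
does not vanish under `φ`. -/
def EvalsTo {L : Type*} [Field L] (φ : R3 →+* L) (x : K3) (y : L) : Prop :=
  ∃ f g : R3, φ g ≠ 0 ∧ x * algebraMap R3 K3 g = algebraMap R3 K3 f ∧ y * φ g = φ f

namespace EvalsTo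

variable {L : Type*} [Field L] {φ : R3 →+* L} {x x' : K3} {y y' : L}

theorem algebraMap (f : R3) : EvalsTo φ (algebraMap R3 K3 f) (φ f) :=
  ⟨f, 1, by simp, by simp, by simp⟩

theorem one : EvalsTo φ 1 1 := ⟨1, 1, by simp, by simp, by simp⟩

theorem zero : EvalsTo φ 0 0 := ⟨0, 1, by simp, by simp, by simp⟩

theorem add (h : EvalsTo φ x y) (h' : EvalsTo φ x' y') : EvalsTo φ (x + x') (y + y') := by
  obtain ⟨f, g, hg, h1, h2⟩ := h
  obtain ⟨f', g', hg', h1', h2'⟩ := h'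
  refine ⟨f * g' + f' * g, g * g', by simp [hg, hg'], ?_, ?_⟩
  · simp only [map_mul, map_add, ← h1, ← h1']; ring
  · simp only [map_mul, map_add, ← h2, ← h2']; ring

theorem mul (h : EvalsTo φ x y) (h' : EvalsTo φ x' y') : EvalsTo φ (x * x') (y * y') := by
  obtain ⟨f, g, hg, h1, h2⟩ := h
  obtain ⟨f', g', hg', h1', h2'⟩ := h'
  refine ⟨f * f', g * g', by simp [hg, hg'], ?_, ?_⟩
  · simp only [map_mul, ← h1, ← h1']; ring
  · simp only [map_mul, ← h2, ← h2']; ring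

theorem neg (h : EvalsTo φ x y) : EvalsTo φ (-x) (-y) := by
  obtain ⟨f, g, hg, h1, h2⟩ := h
  exact ⟨-f, g, hg, by simp [h1], by simp [h2]⟩

theorem sub (h : EvalsTo φ x y) (h' : EvalsTo φ x' y') : EvalsTo φ (x - x') (y - y') := by
  simpa only [sub_eq_add_neg] using h.add h'.neg

theorem inv (h : EvalsTo φ x y) (hy : y ≠ 0) : EvalsTo φ x⁻¹ y⁻¹ := by
  obtain ⟨f, g, hg, h1, h2⟩ := h
  have hf : φ f ≠ 0 := h2 ▸ mul_ne_zero hy hg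
  have hx : x ≠ 0 := by
    rintro rfl
    rw [zero_mul, eq_comm, map_eq_zero_iff _ (IsFractionRing.injective R3 K3)] at h1
    exact hf (by rw [h1, map_zero])
  exact ⟨g, f, hf, by rw [← h1, inv_mul_cancel_left₀ hx], by rw [← h2, inv_mul_cancel_left₀ hy]⟩

theorem div (h : EvalsTo φ x y) (h' : EvalsTo φ x' y') (hy' : y' ≠ 0) :
    EvalsTo φ (x / x') (y / y') := by
  simpa only [div_eq_mul_inv] using h.mul (h'.inv hy')

theorem pow (h : EvalsTo φ x y) (k : ℕ) : EvalsTo φ (x ^ k) (y ^ k) := by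
  induction k with
  | zero => simpa using one
  | succ k ih => simpa only [pow_succ] using ih.mul h

theorem zpow (h : EvalsTo φ x y) (hy : y ≠ 0) (k : ℤ) : EvalsTo φ (x ^ k) (y ^ k) := by
  cases k with
  | ofNat k => simpa using h.pow k
  | negSucc k => simpa only [zpow_negSucc] using (h.pow _).inv (pow_ne_zero _ hy)

theorem qPoch (h : EvalsTo φ x y) (h' : EvalsTo φ x' y') (k : ℕ) :
    EvalsTo φ (qPoch x x' k) (qPoch y y' k) := by
  induction k with
  | zero => simpa only [qPoch_zero] using one
  | succ k ih => simpa only [qPoch_succ] using ih.mul (one.sub (h.mul (h'.pow k)))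

theorem sum {s : Finset ℕ} {u : ℕ → K3} {v : ℕ → L} (h : ∀ k ∈ s, EvalsTo φ (u k) (v k)) :
    EvalsTo φ (∑ k ∈ s, u k) (∑ k ∈ s, v k) := by
  induction s using Finset.induction_on with
  | empty => simpa using zero
  | insert k s hk ih =>
    rw [sum_insert hk, sum_insert hk]
    exact (h k (mem_insert_self k s)).add (ih fun j hj => h j (mem_insert_of_mem hj))

end EvalsTo

/-- A prime that is the kernel of a specialization at which a rational function vanishes divides
the numerator of every reduced form of that function. -/
theorem dvd_num_of_evalsTo_zero {L : Type*} [Field L] {φ : R3 →+* L} {π : R3}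
    (hφ : ∀ f, φ f = 0 ↔ π ∣ f) (hπ : Prime π) {x : K3} (hx : EvalsTo φ x 0) {u v : R3}
    (huv : x * algebraMap R3 K3 v = algebraMap R3 K3 u) : π ∣ u := by
  obtain ⟨f, g, hg, h1, h2⟩ := hx
  rw [zero_mul, eq_comm, hφ] at h2
  rw [Ne, hφ] at hg
  have h : u * g = f * v := IsFractionRing.injective R3 K3 (by
    rw [map_mul, map_mul, ← h1, ← huv]; ring)
  exact (hπ.dvd_or_dvd (h ▸ dvd_mul_of_dvd_left h2 v : π ∣ u * g)).resolve_right hg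

theorem prime_of_ker {L : Type*} [Field L] {φ : R3 →+* L} {π : R3}
    (hφ : ∀ f, φ f = 0 ↔ π ∣ f) (hπ : π ≠ 0) : Prime π := by
  refine ⟨hπ, fun h => ?_, fun a b h => ?_⟩
  · have := (hφ 1).2 h.dvd
    simp at this
  · rwa [← hφ, ← hφ, ← mul_eq_zero, ← map_mul, hφ]

theorem congrMod3_zero_of_evalsTo {L₁ L₂ L₃ : Type*} [Field L₁] [Field L₂] [Field L₃]
    {φ₁ : R3 →+* L₁} {φ₂ : R3 →+* L₂} {φ₃ : R3 →+* L₃} {π₁ π₂ π₃ : R3}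
    (h₁ : ∀ f, φ₁ f = 0 ↔ π₁ ∣ f) (h₂ : ∀ f, φ₂ f = 0 ↔ π₂ ∣ f) (h₃ : ∀ f, φ₃ f = 0 ↔ π₃ ∣ f)
    (hπ₁ : π₁ ≠ 0) (hπ₂ : π₂ ≠ 0) (hπ₃ : π₃ ≠ 0)
    (h21 : φ₂ π₁ ≠ 0) (h31 : φ₃ π₁ ≠ 0) (h32 : φ₃ π₂ ≠ 0) {x : K3}
    (hx₁ : EvalsTo φ₁ x 0) (hx₂ : EvalsTo φ₂ x 0) (hx₃ : EvalsTo φ₃ x 0) :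
    CongrMod3 x 0 (π₁ * π₂ * π₃) := by
  have p₁ := prime_of_ker h₁ hπ₁
  have p₂ := prime_of_ker h₂ hπ₂
  have p₃ := prime_of_ker h₃ hπ₃
  rw [Ne, h₂] at h21
  rw [Ne, h₃] at h31 h32
  obtain ⟨u, v, huv, rfl⟩ := IsFractionRing.exists_reduced_fraction (A := R3) x
  have hv : (v : R3) ≠ 0 := nonZeroDivisors.ne_zero v.2
  have heq : IsLocalization.mk' K3 u v * algebraMap R3 K3 v = algebraMap R3 K3 u :=
    IsLocalization.mk'_spec K3 u v
  have d₁ := dvd_num_of_evalsTo_zero h₁ p₁ hx₁ heq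
  have d₂ := dvd_num_of_evalsTo_zero h₂ p₂ hx₂ heq
  have d₃ := dvd_num_of_evalsTo_zero h₃ p₃ hx₃ heq
  have hcop : ∀ {π r : R3}, π ∣ u → Prime r → r ∣ (v : R3) → ¬ r ∣ π := fun hu hr hrv hrπ =>
    hr.not_isUnit (huv (hrπ.trans hu) hrv)
  obtain ⟨f, hf⟩ : π₁ * π₂ * π₃ ∣ u := by
    obtain ⟨w, rfl⟩ := d₁
    obtain ⟨w, rfl⟩ := (p₂.dvd_or_dvd d₂).resolve_left h21
    obtain ⟨w, rfl⟩ := (p₃.dvd_or_dvd ((p₃.dvd_or_dvd d₃).resolve_left h31)).resolve_left h32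
    exact ⟨w, by ring⟩
  refine ⟨f, v, hv, fun r hr hrv hdvd => ?_, by rw [sub_zero, heq, hf, map_mul]⟩
  rcases hr.dvd_or_dvd hdvd with h | h
  · rcases hr.dvd_or_dvd h with h | h
    · exact hcop d₁ hr hrv h
    · exact hcop d₂ hr hrv h
  · exact hcop d₃ hr hrv h

open MvPolynomial in
theorem ker_iff_dvd_of_comp_eq_mk {R' L : Type*} [CommRing R'] [Field L] {ι : R' →+* L}
    (hι : Function.Injective ι) {φ : R3 →+* R'} {π : R3} (hπ : φ π = 0)
    (ψ : R' →+* R3 ⧸ Ideal.span {π}) (hψ : ∀ i, ψ (φ (X i)) = Ideal.Quotient.mk _ (X i)) (f : R3) :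
    ι.comp φ f = 0 ↔ π ∣ f := by
  have hmk : ψ.comp φ = Ideal.Quotient.mk _ :=
    MvPolynomial.ringHom_ext (fun c => by
      have := RingHom.ext_rat ((ψ.comp φ).comp C) ((Ideal.Quotient.mk (Ideal.span {π})).comp C)
      exact RingHom.congr_fun this c) hψ
  rw [RingHom.comp_apply, map_eq_zero_iff ι hι]
  constructor
  · intro h
    rw [← Ideal.mem_span_singleton, ← Ideal.Quotient.eq_zero_iff_mem, ← hmk, RingHom.comp_apply, h,
      map_zero]
  · rintro ⟨g, rfl⟩
    rw [map_mul, hπ, zero_mul]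

open MvPolynomial in
theorem exists_specialization_sub_pow (n : ℕ) : ∃ φ : R3 →+* K3,
    (∀ f, φ f = 0 ↔ (X 1 - X 0 ^ n : R3) ∣ f) ∧ φ (X 0) = qv ∧ φ (X 1) = qv ^ n ∧
      φ (X 2) = ev := by
  let φ : R3 →ₐ[ℚ] R3 := aeval ![X 0, X 0 ^ n, X 2]
  refine ⟨(algebraMap R3 K3).comp φ.toRingHom, ?_, ?_, ?_, ?_⟩
  · refine ker_iff_dvd_of_comp_eq_mk (IsFractionRing.injective R3 K3) (by simp [φ])
      (Ideal.Quotient.mk _) fun i => ?_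
    fin_cases i
    · simp [φ]
    · have h : Ideal.Quotient.mk (Ideal.span {(X 1 - X 0 ^ n : R3)}) (X 0 ^ n) =
          Ideal.Quotient.mk _ (X 1) := by
        rw [Ideal.Quotient.eq, Ideal.mem_span_singleton]
        exact dvd_sub_comm.1 dvd_rfl
      simpa [φ] using h
    · simp [φ]
  · simp [φ, qv]
  · simp [φ, qv]
  · simp [φ, ev]

open MvPolynomial in
theorem exists_specialization_one_sub_mul_pow (n : ℕ) : ∃ φ : R3 →+* K3,
    (∀ f, φ f = 0 ↔ (1 - X 1 * X 0 ^ n : R3) ∣ f) ∧ φ (X 0) = qv ∧ φ (X 1) = (qv ^ n)⁻¹ ∧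
      φ (X 2) = ev := by
  rcases Nat.eq_zero_or_pos n with rfl | hn
  · obtain ⟨φ, h, h0, h1, h2⟩ := exists_specialization_sub_pow 0
    refine ⟨φ, fun f => ?_, h0, by simpa using h1, h2⟩
    rw [h, ← neg_dvd]
    simp
  have hX : (X 0 : R3) ≠ 0 := X_ne_zero 0
  have hq : qv ≠ 0 := (map_ne_zero_iff _ (IsFractionRing.injective R3 K3)).2 hX
  have hinj : Function.Injective (algebraMap R3 (Localization.Away (X 0 : R3))) :=
    IsLocalization.injective _ (powers_le_nonZeroDivisors_of_noZeroDivisors hX)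
  let ι : Localization.Away (X 0 : R3) →+* K3 :=
    IsLocalization.Away.lift (X 0) (g := algebraMap R3 K3) hq.isUnit
  have hι : Function.Injective ι := (IsLocalization.lift_injective_iff _).2 fun x y => by
    rw [hinj.eq_iff, (IsFractionRing.injective R3 K3).eq_iff]
  have hιX : ∀ f, ι (algebraMap R3 _ f) = algebraMap R3 K3 f := fun f =>
    IsLocalization.Away.lift_eq _ _ f
  let φ : R3 →ₐ[ℚ] Localization.Away (X 0 : R3) :=
    aeval ![algebraMap R3 _ (X 0), IsLocalization.Away.invSelf (X 0 : R3) ^ n, algebraMap R3 _ (X 2)]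
  have hXinv : IsLocalization.Away.invSelf (X 0 : R3) *
      algebraMap R3 (Localization.Away (X 0 : R3)) (X 0) = 1 :=
    (mul_comm _ _).trans (IsLocalization.Away.mul_invSelf _)
  have hmk : Ideal.Quotient.mk (Ideal.span {(1 - X 1 * X 0 ^ n : R3)}) (X 1) *
      Ideal.Quotient.mk _ (X 0) ^ n = 1 := by
    rw [← map_pow, ← map_mul, ← map_one (Ideal.Quotient.mk _), Ideal.Quotient.eq,
      Ideal.mem_span_singleton]
    exact dvd_sub_comm.1 dvd_rfl
  have hunit : IsUnit (Ideal.Quotient.mk (Ideal.span {(1 - X 1 * X 0 ^ n : R3)}) (X 0)) :=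
    (isUnit_pow_iff hn.ne').1 (IsUnit.of_mul_eq_one_right _ hmk)
  let ψ := IsLocalization.Away.lift (S := Localization.Away (X 0 : R3)) (X 0) hunit
  have hψX : ∀ f, ψ (algebraMap R3 _ f) = Ideal.Quotient.mk _ f := fun f =>
    IsLocalization.Away.lift_eq _ _ f
  refine ⟨ι.comp φ.toRingHom, ?_, ?_, ?_, ?_⟩
  · refine ker_iff_dvd_of_comp_eq_mk hι ?_ ψ fun i => ?_
    · simp [φ, ← mul_pow, hXinv]
    · fin_cases i
      · simp [φ, hψX]
      · have h : ψ (IsLocalization.Away.invSelf (X 0 : R3)) ^ n * Ideal.Quotient.mk _ (X 0) ^ n = 1 := by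
          rw [← hψX, ← map_pow, ← map_pow, ← map_mul, ← mul_pow, hXinv, one_pow, map_one]
        simpa [φ] using (hunit.pow n).mul_right_cancel (h.trans hmk.symm)
      · simp [φ, hψX]
  · simp [φ, hιX, qv]
  · have h : ι (IsLocalization.Away.invSelf (X 0 : R3)) ^ n * qv ^ n = 1 := by
      rw [qv, ← hιX, ← map_pow, ← map_pow, ← map_mul, ← mul_pow, hXinv, one_pow, map_one]
    simpa [φ] using eq_inv_of_mul_eq_one_left h
  · simp [φ, hιX, ev]

open MvPolynomial in
theorem exists_specialization_cyclotomic {n : ℕ} (hn : 0 < n) :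
    ∃ (L : Type) (_ : Field L) (φ : R3 →+* L), (∀ f, φ f = 0 ↔ Phi3 n ∣ f) ∧
      IsPrimitiveRoot (φ (X 0)) n ∧
      (∀ j : ℤ, φ (X 1) ≠ φ (X 0) ^ j) ∧ (∀ j : ℤ, φ (X 2) ≠ φ (X 0) ^ j) ∧
      φ (X 1) ≠ 0 ∧ φ (X 2) ≠ 0 := by
  have : Fact (Irreducible (Polynomial.cyclotomic n ℚ)) :=
    ⟨Polynomial.cyclotomic.irreducible_rat hn⟩
  have : NeZero (n : ℚ) := ⟨by exact_mod_cast hn.ne'⟩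
  let K := AdjoinRoot (Polynomial.cyclotomic n ℚ)
  let ζ : K := AdjoinRoot.root _
  have hroot : Polynomial.aeval ζ (Polynomial.cyclotomic n ℚ) = 0 := by
    rw [Polynomial.aeval_def, Subsingleton.elim (algebraMap ℚ K) (AdjoinRoot.of _)]
    exact AdjoinRoot.eval₂_root _
  have hζ : IsPrimitiveRoot ζ n := by
    have : NeZero (n : K) := ⟨by
      have := (algebraMap ℚ K).injective.ne (NeZero.ne (n : ℚ))
      simpa using this⟩
    rw [← Polynomial.isRoot_cyclotomic_iff, Polynomial.IsRoot.def, ← hroot,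
      Polynomial.aeval_def, Polynomial.eval₂_eq_eval_map, Polynomial.map_cyclotomic]
  let R' := MvPolynomial (Fin 2) K
  let φ : R3 →ₐ[ℚ] R' := aeval ![C ζ, X 0, X 1]
  let ι := algebraMap R' (FractionRing R')
  have hι : Function.Injective ι := IsFractionRing.injective _ _
  have hPhi : ∀ {T : Type} [CommRing T] [Algebra ℚ T] (χ : R3 →ₐ[ℚ] T),
      χ (Phi3 n) = Polynomial.aeval (χ (X 0)) (Polynomial.cyclotomic n ℚ) := fun χ => by
    rw [Phi3, Polynomial.aeval_algHom_apply]
  let mk := Ideal.Quotient.mkₐ ℚ (Ideal.span {Phi3 n})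
  have hmk : Polynomial.aeval (mk (X 0)) (Polynomial.cyclotomic n ℚ) = 0 := by
    rw [← hPhi]
    exact Ideal.Quotient.eq_zero_iff_mem.2 (Ideal.mem_span_singleton_self _)
  let ψ : R' →+* R3 ⧸ Ideal.span {Phi3 n} :=
    eval₂Hom (AdjoinRoot.lift (algebraMap ℚ _) (mk (X 0)) hmk) ![mk (X 1), mk (X 2)]
  have h0 : φ (X 0) = C ζ := by simp [φ]
  have h1 : φ (X 1) = X 0 := by simp [φ]
  have h2 : φ (X 2) = X 1 := by simp [φ]
  have hX : ∀ (i : Fin 2) (c : K), (X i : R') ≠ C c := fun i c h => by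
    have e0 := congrArg (eval (fun _ => 0)) h
    have e1 := congrArg (eval (fun _ => 1)) h
    simp only [eval_X, eval_C] at e0 e1
    exact zero_ne_one (e0.trans e1.symm)
  have hpow : ∀ (i : Fin 2) (j : ℤ), ι (X i) ≠ ι (C ζ) ^ j := fun i j h => by
    refine hX i (ζ ^ j) (hι ?_)
    rw [h]
    exact (map_zpow₀ (ι.comp C) ζ j).symm
  refine ⟨FractionRing R', inferInstance, ι.comp φ.toRingHom, ?_, ?_, ?_, ?_, ?_, ?_⟩
  · refine ker_iff_dvd_of_comp_eq_mk hι ?_ ψ fun i => ?_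
    · change φ (Phi3 n) = 0
      rw [hPhi, h0]
      exact (Polynomial.aeval_algebraMap_apply R' ζ _).trans (by rw [hroot, map_zero])
    · fin_cases i
      · change ψ (φ (X 0)) = mk (X 0)
        rw [h0]
        exact (eval₂Hom_C _ _ _).trans (AdjoinRoot.lift_root _)
      · change ψ (φ (X 1)) = mk (X 1)
        rw [h1]
        exact eval₂Hom_X' _ _ _
      · change ψ (φ (X 2)) = mk (X 2)
        rw [h2]
        exact eval₂Hom_X' _ _ _
  · simpa [h0] using (hζ.map_of_injective (C_injective (Fin 2) K)).map_of_injective hι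
  · intro j
    simpa [h0, h1] using hpow 0 j
  · intro j
    simpa [h0, h2] using hpow 1 j
  · simpa [h1] using (map_ne_zero_iff ι hι).2 (X_ne_zero (R := K) (0 : Fin 2))
  · simpa [h2] using (map_ne_zero_iff ι hι).2 (X_ne_zero (R := K) (1 : Fin 2))

/-- The summand of the congruence, for arbitrary values of `q`, `a` and `e` in a field. -/
def quadSummand {K : Type*} [Field K] (d : ℕ) (q a e : K) (k : ℕ) : K :=
  qInt q (3 * (d : ℤ) * k - 1) *
    (qPoch (q ^ (-1 : ℤ)) (q ^ (2 * d)) k * qPoch e (q ^ (2 * d)) k *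
      qPoch (q ^ ((d : ℤ) - 1) / e) (q ^ (2 * d)) k) *
    (qPoch (a * q) (q ^ d) k * qPoch (q / a) (q ^ d) k *
      qPoch (q ^ ((d : ℤ) - 3)) (q ^ d) k) *
    q ^ (d * k) /
    (qPoch (q ^ d) (q ^ d) k * qPoch e (q ^ d) k *
      qPoch (q ^ ((d : ℤ) - 1) / e) (q ^ d) k *
      (qPoch (a * q ^ (2 * d - 2)) (q ^ (2 * d)) k *
        qPoch (q ^ (2 * d - 2) / a) (q ^ (2 * d)) k *
        qPoch (q ^ (d + 2)) (q ^ (2 * d)) k))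

theorem zpow_mul_pow_pow {K : Type*} [Field K] {q : K} (hq : q ≠ 0) (z : ℤ) (d i : ℕ) :
    q ^ z * (q ^ d) ^ i = q ^ (z + d * i) := by
  rw [zpow_add₀ hq, ← pow_mul, ← zpow_natCast q (d * i), Nat.cast_mul]

theorem mul_zpow_ne_one {K : Type*} [Field K] {q x : K} {z : ℤ} (hx : x ≠ q ^ (-z)) :
    x * q ^ z ≠ 1 := fun h => hx (by rw [zpow_neg]; exact eq_inv_of_mul_eq_one_left h)

theorem zpow_div_ne_one {K : Type*} [Field K] {q x : K} {z : ℤ} (hx : x ≠ q ^ z) :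
    q ^ z / x ≠ 1 := fun h => hx (eq_of_div_eq_one h).symm

theorem quadSummand_eq {K : Type*} [Field K] {d : ℕ} (hd : 1 ≤ d) {q a e : K} (hq : q ≠ 0)
    (ha : a ≠ 0) (k : ℕ) : quadSummand d q a e k =
      quadTerm (q ^ d) (q ^ (-1 : ℤ)) (a * q) (q / a) (q ^ ((d : ℤ) - 3)) e
        (q ^ ((d : ℤ) - 1) / e) k / (1 - q) := by
  have h1 : q ^ (3 * (d : ℤ) * k - 1) = q ^ (-1 : ℤ) * (q ^ d) ^ (3 * k) := by
    rw [zpow_mul_pow_pow hq]; congr 1; push_cast; ring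
  have h2 : q * q ^ ((d : ℤ) - 3) * q ^ d = q ^ (2 * d - 2) := by
    have := zpow_mul_pow_pow hq ((d : ℤ) - 2) d 1
    rw [← zpow_one_add₀ hq, ← zpow_natCast q (2 * d - 2), ← pow_one (q ^ d), ← zpow_natCast q d]
    rw [show 1 + ((d : ℤ) - 3) = d - 2 by ring, zpow_natCast, this]
    congr 1
    push_cast [show 2 ≤ 2 * d by omega]
    ring
  simp only [quadSummand, quadTerm, quadWeight, qInt]
  rw [h1, ← pow_mul q d k, ← pow_mul q d 2, mul_comm d 2,
    show a * q * q ^ ((d : ℤ) - 3) * q ^ d = a * q ^ (2 * d - 2) by rw [← h2]; ring,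
    show q / a * q ^ ((d : ℤ) - 3) * q ^ d = q ^ (2 * d - 2) / a by rw [← h2]; ring,
    show a * q * (q / a) * q ^ d = q ^ (d + 2) by field_simp; ring]
  ring

theorem evalsTo_quadSummand {L : Type*} [Field L] {φ : R3 →+* L} {d k : ℕ} (hd : 1 ≤ d)
    {q a e : L} (hφq : φ (MvPolynomial.X 0) = q) (hφa : φ (MvPolynomial.X 1) = a)
    (hφe : φ (MvPolynomial.X 2) = e) (hq : q ≠ 0) (hq1 : q ≠ 1) (ha0 : a ≠ 0) (he0 : e ≠ 0)
    (ha : ∀ j : ℤ, a ≠ q ^ (2 * j)) (he : ∀ j : ℤ, e ≠ q ^ j)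
    (hp : ∀ i < k, q ^ ((d : ℤ) + d * i) ≠ 1)
    (hBC : ∀ i < k, q ^ ((d + 2 : ℕ) + (2 * d : ℕ) * i : ℤ) ≠ 1) :
    EvalsTo φ (quadSummand d qv av ev k) (quadSummand d q a e k) := by
  have Q : EvalsTo φ qv q := hφq ▸ EvalsTo.algebraMap _
  have A : EvalsTo φ av a := hφa ▸ EvalsTo.algebraMap _
  have E : EvalsTo φ ev e := hφe ▸ EvalsTo.algebraMap _
  have hH := (Q.zpow hq ((d : ℤ) - 1)).div E he0
  have d1 : qPoch (q ^ d) (q ^ d) k ≠ 0 := qPoch_ne_zero fun i hi => by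
    have := zpow_mul_pow_pow hq d d i
    rw [zpow_natCast] at this
    rw [this]
    exact hp i hi
  have d2 : qPoch e (q ^ d) k ≠ 0 := qPoch_ne_zero fun i _ => by
    rw [← pow_mul, ← zpow_natCast]
    exact mul_zpow_ne_one (he _)
  have d3 : qPoch (q ^ ((d : ℤ) - 1) / e) (q ^ d) k ≠ 0 := qPoch_ne_zero fun i _ => by
    rw [div_mul_eq_mul_div, zpow_mul_pow_pow hq]
    exact zpow_div_ne_one (he _)
  have d4 : qPoch (a * q ^ (2 * d - 2)) (q ^ (2 * d)) k ≠ 0 := qPoch_ne_zero fun i _ => by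
    rw [mul_assoc, ← pow_mul, ← pow_add, ← zpow_natCast]
    refine mul_zpow_ne_one ?_
    convert ha (-(d - 1 + d * i)) using 2
    push_cast [show 2 ≤ 2 * d by omega]
    ring
  have d5 : qPoch (q ^ (2 * d - 2) / a) (q ^ (2 * d)) k ≠ 0 := qPoch_ne_zero fun i _ => by
    rw [div_mul_eq_mul_div, ← pow_mul, ← pow_add, ← zpow_natCast]
    refine zpow_div_ne_one ?_
    convert ha (d - 1 + d * i) using 2
    push_cast [show 2 ≤ 2 * d by omega]
    ring
  have d6 : qPoch (q ^ (d + 2)) (q ^ (2 * d)) k ≠ 0 := qPoch_ne_zero fun i hi => by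
    have := zpow_mul_pow_pow hq (d + 2 : ℕ) (2 * d) i
    rw [zpow_natCast] at this
    rw [this]
    exact hBC i hi
  refine EvalsTo.div (EvalsTo.mul (EvalsTo.mul (EvalsTo.mul ?_ ?_) ?_) (Q.pow _)) ?_
    (mul_ne_zero (mul_ne_zero (mul_ne_zero d1 d2) d3) (mul_ne_zero (mul_ne_zero d4 d5) d6))
  · exact (EvalsTo.one.sub (Q.zpow hq _)).div (EvalsTo.one.sub Q) (sub_ne_zero.2 hq1.symm)
  · exact (((Q.zpow hq _).qPoch (Q.pow _) k).mul (E.qPoch (Q.pow _) k)).mul (hH.qPoch (Q.pow _) k)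
  · exact (((A.mul Q).qPoch (Q.pow _) k).mul ((Q.div A ha0).qPoch (Q.pow _) k)).mul
      ((Q.zpow hq _).qPoch (Q.pow _) k)
  · exact ((((Q.pow _).qPoch (Q.pow _) k).mul (E.qPoch (Q.pow _) k)).mul
      (hH.qPoch (Q.pow _) k)).mul ((((A.mul (Q.pow _)).qPoch (Q.pow _) k).mul
        (((Q.pow _).div A ha0).qPoch (Q.pow _) k)).mul ((Q.pow _).qPoch (Q.pow _) k))

theorem sum_quadSummand_eq_zero_of_a {L : Type*} [Field L] {d m : ℕ} (hd : 1 ≤ d)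
    (hdeven : Even d) {q a e : L} (hq0 : q ≠ 0) (hq : ∀ j : ℤ, j ≠ 0 → q ^ j ≠ 1) (he0 : e ≠ 0)
    (he : ∀ j : ℤ, e ≠ q ^ j)
    (ha : a = q ^ (d + 1 + 2 * d * m) ∨ a = (q ^ (d + 1 + 2 * d * m))⁻¹)
    {K : ℕ} (hK : 2 * m + 1 < K) : ∑ k ∈ range K, quadSummand d q a e k = 0 := by
  obtain ⟨c, rfl⟩ := hdeven
  set d := c + c with hdc
  have ha0 : a ≠ 0 := by rcases ha with rfl | rfl <;> simp [hq0]
  rw [sum_congr rfl fun k _ => quadSummand_eq hd hq0 ha0 k, ← sum_div]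
  refine div_eq_zero_iff.2 (Or.inl ?_)
  have hprod : q ^ (-1 : ℤ) * q ^ d = a * q * (q / a) * q ^ ((d : ℤ) - 3) := by
    rw [show a * q * (q / a) = q ^ (2 : ℤ) by field_simp, ← zpow_add₀ hq0,
      ← zpow_natCast, ← zpow_add₀ hq0]
    congr 1; ring
  have hEH : q ^ (-1 : ℤ) * q ^ d = e * (q ^ ((d : ℤ) - 1) / e) := by
    rw [mul_div_cancel₀ _ he0, ← zpow_natCast, ← zpow_add₀ hq0, neg_add_eq_sub]
  have hBC : ∀ i : ℕ, a * q * (q / a) * q ^ d * (q ^ d) ^ i ≠ 1 := fun i => by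
    rw [show a * q * (q / a) * q ^ d * (q ^ d) ^ i = q ^ ((2 + d + d * i : ℕ) : ℤ) by
      rw [zpow_natCast]; field_simp; ring]
    exact hq _ (by positivity)
  have main := fun {B C : L} => quadTerm_sum_eq_zero_of_B (p := q ^ d) (A := q ^ (-1 : ℤ))
    (F := q ^ ((d : ℤ) - 3)) (E := e) (H := q ^ ((d : ℤ) - 1) / e) (B := B) (C := C) m
    (pow_ne_zero _ hq0) (zpow_ne_zero _ hq0) hEH
    (fun i => by
      rw [← pow_succ', ← pow_mul, ← zpow_natCast]
      exact hq _ (by positivity))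
    (fun i => by
      rw [← pow_mul, ← zpow_natCast]
      exact mul_zpow_ne_one (he _))
    (fun i => by
      rw [div_mul_eq_mul_div, zpow_mul_pow_pow hq0]
      exact zpow_div_ne_one (he _))
    (fun i => by
      rw [← zpow_natCast, ← zpow_mul, ← zpow_add₀ hq0]
      refine hq _ fun h => ?_
      have : (2 : ℤ) ∣ 3 := ⟨c + c * i, by rw [hdc] at h; push_cast at h; linarith⟩
      norm_num at this)
    (fun i => by
      rw [zpow_mul_pow_pow hq0]
      refine hq _ fun h => ?_
      have : (2 : ℤ) ∣ 1 := ⟨c * i, by rw [hdc] at h; push_cast at h; linarith⟩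
      norm_num at this)
  rcases ha with ha | ha
  · have hsum := main (B := q / a) (C := a * q) (by rw [hprod]; ring)
      (by rw [ha, ← pow_mul, div_mul_eq_mul_div, div_eq_one_iff_eq (pow_ne_zero _ hq0)]; ring)
      (fun i => by rw [mul_comm (q / a)]; exact hBC i) K hK
    rw [← hsum]
    exact sum_congr rfl fun k _ => by rw [quadTerm, quadTerm, quadWeight_swap]
  · refine main hprod ?_ hBC K hK
    rw [ha, ← pow_mul, mul_assoc, inv_mul_eq_one₀ (pow_ne_zero _ hq0)]
    ring

theorem not_dvd_of_le_half {c T i : ℕ} (hc : 1 ≤ c) (hT : 1 ≤ T) (hi : i ≤ c * T) :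
    ¬ ((2 * c * T + 1 : ℕ) : ℤ) ∣ (2 * c + 2 : ℕ) + (2 * (2 * c) : ℕ) * i := by
  intro h
  have h' : ((2 * c * T + 1 : ℕ) : ℤ) ∣ 2 * T - 1 - 2 * i := by
    obtain ⟨w, hw⟩ := h
    refine ⟨T * w - (1 + 2 * i), ?_⟩
    push_cast at hw ⊢
    linear_combination (T : ℤ) * hw
  have hcT : T ≤ c * T := Nat.le_mul_of_pos_left T hc
  have h0 := Int.eq_zero_of_abs_lt_dvd h' (by
    rw [mul_assoc]; generalize c * T = x at *
    rw [abs_lt]; push_cast; omega)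
  omega

theorem not_dvd_mul_of_le_half {c T i : ℕ} (hc : 1 ≤ c) (hT : 1 ≤ T) (hi : i ≤ c * T) :
    ¬ ((2 * c * T + 1 : ℕ) : ℤ) ∣ (2 * c : ℕ) + (2 * c : ℕ) * i := by
  intro h
  have h' : ((2 * c * T + 1 : ℕ) : ℤ) ∣ (i + 1 : ℕ) := by
    obtain ⟨w, hw⟩ := h
    refine ⟨i + 1 - T * w, ?_⟩
    push_cast at hw ⊢
    linear_combination -(T : ℤ) * hw
  have hcT : 1 ≤ c * T := Nat.mul_pos hc hT
  have := Nat.le_of_dvd (Nat.succ_pos i) (Int.natCast_dvd_natCast.1 h')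
  rw [mul_assoc] at this
  omega

theorem sum_quadSummand_eq_zero_of_isPrimitiveRoot {L : Type*} [Field L] {c m : ℕ} (hc : 1 ≤ c)
    {q a e : L} (hq : IsPrimitiveRoot q (2 * c * (2 * m + 1) + 1)) (ha0 : a ≠ 0) (he0 : e ≠ 0)
    (ha : ∀ j : ℤ, a ≠ q ^ j) (he : ∀ j : ℤ, e ≠ q ^ j) {M : ℕ}
    (hM : c + m * (2 * c - 1) ≤ M) :
    ∑ k ∈ range (M + 1), quadSummand (2 * c) q a e k = 0 := by
  have hq0 : q ≠ 0 := hq.ne_zero (Nat.succ_ne_zero _)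
  set N := c + m * (2 * c - 1) with hN
  have hNc : N ≤ c * (2 * m + 1) := by
    have : m * (2 * c - 1) ≤ m * (2 * c) := Nat.mul_le_mul_left _ (Nat.sub_le _ _)
    rw [hN]; nlinarith
  rw [sum_congr rfl fun k _ => quadSummand_eq (d := 2 * c) (by omega) hq0 ha0 k, ← sum_div]
  refine div_eq_zero_iff.2 (Or.inl ?_)
  have hA : q ^ (-1 : ℤ) * (q ^ (2 * c)) ^ (2 * N) = 1 := by
    rw [zpow_mul_pow_pow hq0, hq.zpow_eq_one_iff_dvd]
    refine ⟨2 * c - 1, ?_⟩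
    rw [hN]
    push_cast [show 1 ≤ 2 * c by omega]
    ring
  have hBCq : a * q * (q / a) = q ^ (2 : ℤ) := by field_simp
  have hprod : q ^ (-1 : ℤ) * q ^ (2 * c) = a * q * (q / a) * q ^ (((2 * c : ℕ) : ℤ) - 3) := by
    rw [hBCq, ← zpow_add₀ hq0, ← zpow_natCast, ← zpow_add₀ hq0]
    congr 1; ring
  have hEH : q ^ (-1 : ℤ) * q ^ (2 * c) = e * (q ^ (((2 * c : ℕ) : ℤ) - 1) / e) := by
    rw [mul_div_cancel₀ _ he0, ← zpow_natCast, ← zpow_add₀ hq0, neg_add_eq_sub]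
  rw [← sum_subset (range_subset_range.2 (Nat.succ_le_succ hM)) fun k _ hk => ?_]
  · refine quadTerm_sum_eq_zero_of_A N (pow_ne_zero _ hq0) (fun i => ?_) hprod hEH hA
      (fun i hi => ?_) (fun i hi => ?_) (fun i => ?_) (fun i => ?_) (fun i => ?_) (fun i => ?_)
    · rw [← pow_mul, ← zpow_natCast]
      exact mul_zpow_ne_one (he _)
    · have := zpow_mul_pow_pow hq0 (2 * c : ℕ) (2 * c) i
      rw [zpow_natCast] at this
      rw [this, Ne, hq.zpow_eq_one_iff_dvd]
      exact not_dvd_mul_of_le_half hc (Nat.succ_pos _) (hi.trans hNc)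
    · rw [hBCq, ← zpow_natCast q (2 * c), ← zpow_add₀ hq0, zpow_natCast, zpow_mul_pow_pow hq0, Ne,
        hq.zpow_eq_one_iff_dvd]
      convert not_dvd_of_le_half hc (Nat.succ_pos _) (hi.trans hNc) using 2
      push_cast; ring
    · rw [div_mul_eq_mul_div, zpow_mul_pow_pow hq0]
      exact zpow_div_ne_one (he _)
    · rw [zpow_mul_pow_pow hq0]
      exact (he _).symm
    · rw [mul_assoc, mul_assoc, zpow_mul_pow_pow hq0, ← zpow_one_add₀ hq0]
      exact mul_zpow_ne_one (ha _)
    · rw [mul_assoc, zpow_mul_pow_pow hq0, div_mul_eq_mul_div, ← zpow_one_add₀ hq0]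
      exact zpow_div_ne_one (ha _)
  · rw [mem_range, not_lt] at hk
    rw [quadTerm, quadWeight, qPoch_eq_zero (N := N) (by rw [← pow_mul]; exact hA) hk]
    simp

theorem qv_ne_zero : qv ≠ 0 :=
  (map_ne_zero_iff _ (IsFractionRing.injective R3 K3)).2 (MvPolynomial.X_ne_zero 0)

theorem ev_ne_zero : ev ≠ 0 :=
  (map_ne_zero_iff _ (IsFractionRing.injective R3 K3)).2 (MvPolynomial.X_ne_zero 2)

theorem qv_zpow_ne_one {j : ℤ} (hj : j ≠ 0) : qv ^ j ≠ 1 := by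
  have key : ∀ i : ℕ, i ≠ 0 → qv ^ i ≠ 1 := fun i hi h => by
    rw [qv, ← map_pow, ← map_one (algebraMap R3 K3)] at h
    have := congrArg (MvPolynomial.eval 0) (IsFractionRing.injective R3 K3 h)
    simp [hi] at this
  obtain ⟨i, rfl | rfl⟩ := j.eq_nat_or_neg
  · simpa using key i (by simpa using hj)
  · simpa using key i (by simpa using hj)

theorem ev_ne_qv_zpow (j : ℤ) : ev ≠ qv ^ j := by
  intro h
  obtain ⟨i, rfl | rfl⟩ := j.eq_nat_or_neg
  · rw [zpow_natCast, qv, ev, ← map_pow] at h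
    have := congrArg (MvPolynomial.eval ![1, 0, 0]) (IsFractionRing.injective R3 K3 h)
    simp at this
  · rw [zpow_neg, zpow_natCast, ← mul_eq_one_iff_eq_inv₀ (pow_ne_zero _ qv_ne_zero), qv, ev, ← map_pow,
      ← map_mul, ← map_one (algebraMap R3 K3)] at h
    have := congrArg (MvPolynomial.eval ![1, 0, 0]) (IsFractionRing.injective R3 K3 h)
    simp at this

theorem map_Phi3_ne_zero {n : ℕ} (hn : 0 < n) {φ : R3 →+* K3}
    (hφ : φ (MvPolynomial.X 0) = qv) : φ (Phi3 n) ≠ 0 := by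
  intro h
  obtain ⟨f, hf⟩ := Polynomial.cyclotomic.dvd_X_pow_sub_one n ℚ
  have h' := congrArg (fun g => φ (Polynomial.aeval (MvPolynomial.X 0 : R3) g)) hf
  simp only [map_mul, map_sub, map_pow, map_one, Polynomial.aeval_X, hφ] at h'
  rw [← Phi3, h, zero_mul, sub_eq_zero] at h'
  exact qv_zpow_ne_one (Int.natCast_ne_zero.2 hn.ne') (by rw [zpow_natCast]; exact h')

theorem evalsTo_sum_quadSummand_of_a {φ : R3 →+* K3} {c m M : ℕ} {a : K3} (hc : 1 ≤ c)
    (hM : 2 * m + 1 ≤ M) (hφq : φ (MvPolynomial.X 0) = qv) (hφa : φ (MvPolynomial.X 1) = a)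
    (hφe : φ (MvPolynomial.X 2) = ev) (ha : a = qv ^ (2 * c * (2 * m + 1) + 1) ∨
      a = (qv ^ (2 * c * (2 * m + 1) + 1))⁻¹) :
    EvalsTo φ (∑ k ∈ range (M + 1), quadSummand (2 * c) qv av ev k) 0 := by
  have ha0 : a ≠ 0 := by rcases ha with rfl | rfl <;> simp [qv_ne_zero]
  have hinj : ∀ i j : ℤ, i ≠ j → qv ^ i ≠ qv ^ j := fun i j hij h => by
    refine qv_zpow_ne_one (sub_ne_zero.2 hij) ?_
    rw [zpow_sub₀ qv_ne_zero, h, div_self (zpow_ne_zero _ qv_ne_zero)]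
  have hodd : ∀ j : ℤ, a ≠ qv ^ (2 * j) := fun j => by
    rcases ha with rfl | rfl
    · rw [← zpow_natCast]
      exact hinj _ _ (by rw [mul_assoc]; push_cast; omega)
    · rw [← zpow_natCast, ← zpow_neg]
      exact hinj _ _ (by rw [mul_assoc]; push_cast; omega)
  rw [← sum_quadSummand_eq_zero_of_a (d := 2 * c) (by omega) (even_two_mul c) qv_ne_zero
    (fun j => qv_zpow_ne_one) ev_ne_zero ev_ne_qv_zpow
    (by rw [show 2 * c + 1 + 2 * (2 * c) * m = 2 * c * (2 * m + 1) + 1 by ring]; exact ha)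
    (Nat.lt_succ_of_le hM)]
  exact EvalsTo.sum fun k _ => evalsTo_quadSummand (by omega) hφq hφa hφe qv_ne_zero
    (by simpa using qv_zpow_ne_one one_ne_zero) ha0 ev_ne_zero hodd ev_ne_qv_zpow
    (fun i _ => qv_zpow_ne_one (by positivity)) (fun i _ => qv_zpow_ne_one (by positivity))

/-- Theorem 3.1: for even `d ≥ 2` and `n ≡ d+1 (mod 2d)`, with `M = (n-1)/2` if `d = 2`
and `M = (dn-n+1)/(2d)` otherwise,
`Σ_{k=0}^{M} [3dk-1] (q^{-1},e,q^{d-1}/e;q^{2d})_k (aq,q/a,q^{d-3};q^d)_k q^{dk} /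
((q^d,e,q^{d-1}/e;q^d)_k (aq^{2d-2},q^{2d-2}/a,q^{d+2};q^{2d})_k)
≡ 0 (mod Φ_n(q)(1-aq^n)(a-q^n))`. -/
theorem stmt11 (d : ℕ) (hd2 : 2 ≤ d) (hdeven : Even d) (n : ℕ) (hn : 0 < n)
    (hmod : n % (2 * d) = (d + 1) % (2 * d))
    (M : ℕ) (hM : M = if d = 2 then (n - 1) / 2 else (d * n - n + 1) / (2 * d)) :
    CongrMod3
      (∑ k ∈ Finset.range (M + 1),
        qInt qv (3 * (d : ℤ) * k - 1) *
          (qPoch (qv ^ (-1 : ℤ)) (qv ^ (2 * d)) k * qPoch ev (qv ^ (2 * d)) k *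
            qPoch (qv ^ ((d : ℤ) - 1) / ev) (qv ^ (2 * d)) k) *
          (qPoch (av * qv) (qv ^ d) k * qPoch (qv / av) (qv ^ d) k *
            qPoch (qv ^ ((d : ℤ) - 3)) (qv ^ d) k) *
          qv ^ (d * k) /
          (qPoch (qv ^ d) (qv ^ d) k * qPoch ev (qv ^ d) k *
            qPoch (qv ^ ((d : ℤ) - 1) / ev) (qv ^ d) k *
            (qPoch (av * qv ^ (2 * d - 2)) (qv ^ (2 * d)) k *
              qPoch (qv ^ (2 * d - 2) / av) (qv ^ (2 * d)) k *
              qPoch (qv ^ (d + 2)) (qv ^ (2 * d)) k)))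
      0
      (Phi3 n * (1 - MvPolynomial.X 1 * MvPolynomial.X 0 ^ n) *
        (MvPolynomial.X 1 - MvPolynomial.X 0 ^ n)) := by
  obtain ⟨c, rfl⟩ : ∃ c, d = 2 * c := hdeven.exists_two_nsmul.imp fun c hc => by simpa using hc
  have hc : 1 ≤ c := by omega
  obtain ⟨m, rfl⟩ : ∃ m, n = 2 * c * (2 * m + 1) + 1 := by
    refine ⟨n / (2 * (2 * c)), ?_⟩
    have h := Nat.div_add_mod n (2 * (2 * c))
    rw [hmod, Nat.mod_eq_of_lt (by omega)] at h
    linarith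
  have hcm : c ≤ c * (2 * m + 1) := Nat.le_mul_of_pos_right c (Nat.succ_pos _)
  have hM' : 2 * m + 1 ≤ M ∧ c + m * (2 * c - 1) ≤ M ∧ M ≤ c * (2 * m + 1) := by
    obtain ⟨b, rfl⟩ : ∃ b, c = b + 1 := ⟨c - 1, by omega⟩
    rw [show 2 * (b + 1) - 1 = 2 * b + 1 by omega]
    split_ifs at hM with hb
    · obtain rfl : b = 0 := by omega
      omega
    · have hM2 : M = b + 1 + m * (2 * b + 1) := by
        rw [hM]
        refine Nat.div_eq_of_eq_mul_right (by omega) ?_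
        rw [← Nat.sub_one_mul, show 2 * (b + 1) - 1 = 2 * b + 1 by omega]
        ring
      have hbm : m ≤ b * m := Nat.le_mul_of_pos_left m (by omega)
      refine ⟨?_, hM2.ge, ?_⟩ <;> rw [hM2] <;> nlinarith
  obtain ⟨hM1, hM2, hM3⟩ := hM'
  change CongrMod3 (∑ k ∈ range (M + 1), quadSummand (2 * c) qv av ev k) 0 _
  obtain ⟨L, _, φ₁, ker₁, hζ, ha, he, ha0, he0⟩ :=
    exists_specialization_cyclotomic (Nat.succ_pos (2 * c * (2 * m + 1)))
  obtain ⟨φ₂, ker₂, h20, h21, h22⟩ :=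
    exists_specialization_one_sub_mul_pow (2 * c * (2 * m + 1) + 1)
  obtain ⟨φ₃, ker₃, h30, h31, h32⟩ := exists_specialization_sub_pow (2 * c * (2 * m + 1) + 1)
  have hlt : ∀ {i k : ℕ}, k ∈ range (M + 1) → i < k → i ≤ c * (2 * m + 1) := fun hk hi => by
    have := mem_range.1 hk
    omega
  have hx₁ : EvalsTo φ₁ (∑ k ∈ range (M + 1), quadSummand (2 * c) qv av ev k) 0 := by
    rw [← sum_quadSummand_eq_zero_of_isPrimitiveRoot hc hζ ha0 he0 ha he hM2]
    refine EvalsTo.sum fun k hk => evalsTo_quadSummand (by omega) rfl rfl rfl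
      (hζ.ne_zero (Nat.succ_ne_zero _)) (hζ.ne_one (by rw [mul_assoc]; omega)) ha0 he0
      (fun j => ha _) he (fun i hi => ?_) (fun i hi => ?_)
    · rw [Ne, hζ.zpow_eq_one_iff_dvd]
      exact not_dvd_mul_of_le_half hc (Nat.succ_pos _) (hlt hk hi)
    · rw [Ne, hζ.zpow_eq_one_iff_dvd]
      exact not_dvd_of_le_half hc (Nat.succ_pos _) (hlt hk hi)
  have h32' : φ₃ (1 - MvPolynomial.X 1 * MvPolynomial.X 0 ^ (2 * c * (2 * m + 1) + 1)) ≠ 0 := by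
    rw [map_sub, map_one, map_mul, map_pow, h31, h30, ← pow_add, ← zpow_natCast]
    exact sub_ne_zero.2 (qv_zpow_ne_one (by positivity)).symm
  have hπ₁ := map_Phi3_ne_zero hn h20
  refine congrMod3_zero_of_evalsTo ker₁ ker₂ ker₃ (fun h => hπ₁ (by rw [h, map_zero]))
    (fun h => h32' (by rw [h, map_zero])) (fun h => ?_) hπ₁ (map_Phi3_ne_zero hn h30) h32' hx₁
    (evalsTo_sum_quadSummand_of_a hc hM1 h20 h21 h22 (Or.inr rfl))
    (evalsTo_sum_quadSummand_of_a hc hM1 h30 h31 h32 (Or.inl rfl))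
  have := congrArg (MvPolynomial.eval ![0, 1, 0]) h
  simp at this

end
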